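/- arXiv:1909.01769 — 7 statements merged into one kernel-verified Lean document; each statement's English description precedes it below -/
import Mathlib

section
/- For every natural number n ≥ 0 and every r ≥ 1: B_{n+r} = Σ_{i=1}^{r} {r,i} · B_{n,i}. -/
open scoped Classical
noncomputable section

/-- The finset of all set-partitions of `Fin m`. -/
def partitionsF (m : ℕ) : Finset (Finset (Finset (Fin m))) :=
  Finset.univ.filter fun P =>
    (∀ S ∈ P, S.Nonempty) ∧
    (∀ S ∈ P, ∀ T ∈ P, S ≠ T → Disjoint S T) ∧
    (∀ i : Fin m, ∃ S ∈ P, i ∈ S)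

/-- The `m`-th Bell number: the number of partitions of an `m`-element set. -/
def bell (m : ℕ) : ℕ := (partitionsF m).card

/-- The `r`-Bell number `B_{m,r}`: the number of partitions of a set of `m + r` elements
in which the `r` distinguished elements (the first `r` elements) lie in pairwise
distinct blocks. -/
def rBell (m r : ℕ) : ℕ :=
  ((partitionsF (m + r)).filter fun P =>
    ∀ S ∈ P, (S.filter fun i => (i : ℕ) < r).card ≤ 1).card

/-- The Stirling number of the second kind `{r, i}`: the number of partitions of an
`r`-element set into exactly `i` nonempty blocks. -/
def stirling2 (r i : ℕ) : ℕ := ((partitionsF r).filter fun P => P.card = i).card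

instance finiteSetoidAux {α : Type*} [Finite α] : Finite (Setoid α) :=
  Finite.of_injective (fun s : Setoid α => (fun x y => s x y : α → α → Prop)) (by
    intro s t h
    ext x y
    exact iff_of_eq (congrFun (congrFun h x) y))

instance fintypeSetoidAux {α : Type*} [Finite α] : Fintype (Setoid α) := Fintype.ofFinite _

/-- The block of a class. -/
def blockOf {m : ℕ} (s : Setoid (Fin m)) (q : Quotient s) : Finset (Fin m) :=
  Finset.univ.filter fun y => Quotient.mk s y = q

theorem mem_blockOf {m : ℕ} (s : Setoid (Fin m)) (q : Quotient s) (y : Fin m) :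
    y ∈ blockOf s q ↔ Quotient.mk s y = q := by simp [blockOf]

theorem blockOf_injective {m : ℕ} (s : Setoid (Fin m)) : Function.Injective (blockOf s) := by
  intro p q h
  obtain ⟨x, rfl⟩ := Quotient.exists_rep p
  have : x ∈ blockOf s (Quotient.mk s x) := (mem_blockOf ..).2 rfl
  rw [h] at this
  exact (mem_blockOf ..).1 this

/-- The blocks of a setoid. -/
def toPart {m : ℕ} (s : Setoid (Fin m)) : Finset (Finset (Fin m)) :=
  Finset.univ.image (blockOf s)

theorem mem_toPart {m : ℕ} (s : Setoid (Fin m)) (S : Finset (Fin m)) :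
    S ∈ toPart s ↔ ∃ q, blockOf s q = S := by simp [toPart]

theorem toPart_mem {m : ℕ} (s : Setoid (Fin m)) : toPart s ∈ partitionsF m := by
  simp only [partitionsF, Finset.mem_filter, Finset.mem_univ, true_and]
  refine ⟨?_, ?_, ?_⟩
  · intro S hS
    obtain ⟨q, rfl⟩ := (mem_toPart ..).1 hS
    obtain ⟨x, rfl⟩ := Quotient.exists_rep q
    exact ⟨x, (mem_blockOf ..).2 rfl⟩
  · intro S hS T hT hne
    obtain ⟨q, rfl⟩ := (mem_toPart ..).1 hS
    obtain ⟨p, rfl⟩ := (mem_toPart ..).1 hT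
    rw [Finset.disjoint_left]
    intro x hx hy
    rw [mem_blockOf] at hx hy
    exact hne (by rw [← hx, ← hy])
  · intro i
    exact ⟨_, (mem_toPart ..).2 ⟨Quotient.mk s i, rfl⟩, (mem_blockOf ..).2 rfl⟩

theorem toPart_rel {m : ℕ} (s : Setoid (Fin m)) (x y : Fin m) :
    s x y ↔ ∃ S ∈ toPart s, x ∈ S ∧ y ∈ S := by
  constructor
  · intro h
    exact ⟨_, (mem_toPart ..).2 ⟨Quotient.mk s x, rfl⟩, (mem_blockOf ..).2 rfl,
      (mem_blockOf ..).2 (Quotient.sound (s.symm h))⟩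
  · rintro ⟨S, hS, hx, hy⟩
    obtain ⟨q, rfl⟩ := (mem_toPart ..).1 hS
    rw [mem_blockOf] at hx hy
    exact Quotient.exact (hx.trans hy.symm)

theorem toPart_injective {m : ℕ} : Function.Injective (toPart (m := m)) := by
  intro s t h
  ext x y
  rw [toPart_rel, toPart_rel, h]

theorem toPart_surj {m : ℕ} (P : Finset (Finset (Fin m))) (hP : P ∈ partitionsF m) :
    ∃ s, toPart s = P := by
  simp only [partitionsF, Finset.mem_filter, Finset.mem_univ, true_and] at hP
  obtain ⟨h1, h2, h3⟩ := hP
  have huniq : ∀ S ∈ P, ∀ T ∈ P, ∀ x, x ∈ S → x ∈ T → S = T := by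
    intro S hS T hT x hx hy
    by_contra hne
    exact Finset.disjoint_left.1 (h2 S hS T hT hne) hx hy
  let s : Setoid (Fin m) :=
    { r := fun x y => ∃ S ∈ P, x ∈ S ∧ y ∈ S
      iseqv := by
        refine ⟨fun x => ?_, ?_, ?_⟩
        · obtain ⟨S, hS, hx⟩ := h3 x
          exact ⟨S, hS, hx, hx⟩
        · rintro x y ⟨S, hS, hx, hy⟩
          exact ⟨S, hS, hy, hx⟩
        · rintro x y z ⟨S, hS, hx, hy⟩ ⟨T, hT, hy', hz⟩
          obtain rfl := huniq S hS T hT y hy hy'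
          exact ⟨S, hS, hx, hz⟩ }
  have key : ∀ S ∈ P, ∀ x ∈ S, blockOf s (Quotient.mk s x) = S := by
    intro S hS x hx
    ext y
    rw [mem_blockOf]
    constructor
    · intro h
      obtain ⟨T, hT, hy, hx'⟩ : ∃ T ∈ P, y ∈ T ∧ x ∈ T := Quotient.exact h
      obtain rfl := huniq S hS T hT x hx hx'
      exact hy
    · intro h
      exact Quotient.sound (show ∃ T ∈ P, y ∈ T ∧ x ∈ T from ⟨S, hS, h, hx⟩)
  refine ⟨s, ?_⟩
  ext S
  rw [mem_toPart]
  constructor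
  · rintro ⟨q, rfl⟩
    obtain ⟨x, rfl⟩ := Quotient.exists_rep q
    obtain ⟨S, hS, hx⟩ := h3 x
    rw [key S hS x hx]
    exact hS
  · intro hS
    obtain ⟨x, hx⟩ := h1 S hS
    exact ⟨_, key S hS x hx⟩

theorem card_filter_partitions {m : ℕ} (p : Finset (Finset (Fin m)) → Prop) [DecidablePred p]
    (q : Setoid (Fin m) → Prop) (h : ∀ s, p (toPart s) ↔ q s) :
    ((partitionsF m).filter p).card = Nat.card {s : Setoid (Fin m) // q s} := by
  rw [Nat.card_eq_fintype_card, Fintype.card_subtype]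
  symm
  refine Finset.card_bij (fun s _ => toPart s) ?_ ?_ ?_
  · intro s hs
    exact Finset.mem_filter.2 ⟨toPart_mem s, (h s).2 (Finset.mem_filter.1 hs).2⟩
  · intro s _ t _ hst
    exact toPart_injective hst
  · intro P hP
    obtain ⟨hP, hp⟩ := Finset.mem_filter.1 hP
    obtain ⟨s, rfl⟩ := toPart_surj P hP
    exact ⟨s, Finset.mem_filter.2 ⟨Finset.mem_univ _, (h s).1 hp⟩, rfl⟩

theorem bell_eq_card (m : ℕ) : bell m = Nat.card (Setoid (Fin m)) := by
  have := card_filter_partitions (m := m) (fun _ => True) (fun _ => True) (fun _ => Iff.rfl)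
  simp only [Finset.filter_true] at this
  rw [bell, this]
  exact Nat.card_congr (Equiv.subtypeUnivEquiv (fun _ => trivial))

theorem stirling2_eq_card (r i : ℕ) :
    stirling2 r i = Nat.card {s : Setoid (Fin r) // Nat.card (Quotient s) = i} := by
  rw [stirling2]
  refine card_filter_partitions (fun P => P.card = i) _ fun s => ?_
  rw [toPart, Finset.card_image_of_injective _ (blockOf_injective s), Finset.card_univ,
    Nat.card_eq_fintype_card]

/-- Reindexing setoids. -/
def setoidCongr {α β : Type*} (e : α ≃ β) : Setoid α ≃ Setoid β where
  toFun s := s.comap e.symm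
  invFun t := t.comap e
  left_inv s := by ext x y; simp [Setoid.comap_rel]
  right_inv s := by ext x y; simp [Setoid.comap_rel]

theorem card_setoid_congr {α β : Type*} (e : α ≃ β) :
    Nat.card (Setoid α) = Nat.card (Setoid β) := Nat.card_congr (setoidCongr e)

/-- The distinguished elements come first. -/
def sumE (n r : ℕ) : Fin r ⊕ Fin n ≃ Fin (n + r) :=
  finSumFinEquiv.trans (finCongr (add_comm r n))

theorem sumE_inl (n r : ℕ) (a : Fin r) : ((sumE n r (Sum.inl a) : Fin (n + r)) : ℕ) = a := by
  simp [sumE]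

theorem comap_inl_eq_bot {γ β : Type*} (u : Setoid (γ ⊕ β)) :
    u.comap Sum.inl = ⊥ ↔ ∀ a b : γ, u (Sum.inl a) (Sum.inl b) → a = b := by
  rw [eq_bot_iff]
  rfl

theorem mem_coeFin {m : ℕ} (S : Finset (Fin m)) (k : ℕ) :
    k ∈ (do let a ← S; pure (a : ℕ) : Finset ℕ) ↔ ∃ a ∈ S, (a : ℕ) = k := by
  simp [Finset.bind_def, eq_comm]

theorem rBell_eq_card (n i : ℕ) :
    rBell n i = Nat.card {u : Setoid (Fin i ⊕ Fin n) // u.comap Sum.inl = ⊥} := by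
  have h := card_filter_partitions (m := n + i)
    (fun P => ∀ S ∈ P, (S.filter fun k => (k : ℕ) < i).card ≤ 1)
    (fun s => (s.comap (sumE n i)).comap Sum.inl = ⊥) (by
      intro s
      rw [comap_inl_eq_bot]
      constructor
      · intro h a b hab
        rw [Setoid.comap_rel, toPart_rel] at hab
        obtain ⟨S, hS, ha, hb⟩ := hab
        have := Finset.card_le_one.1 (h S hS) (a : ℕ)
          (Finset.mem_filter.2 ⟨(mem_coeFin S _).2 ⟨_, ha, sumE_inl n i a⟩, a.2⟩) (b : ℕ)
          (Finset.mem_filter.2 ⟨(mem_coeFin S _).2 ⟨_, hb, sumE_inl n i b⟩, b.2⟩)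
        exact Fin.ext this
      · intro h S hS
        rw [Finset.card_le_one]
        intro x hx y hy
        obtain ⟨hx, hxi⟩ := Finset.mem_filter.1 hx
        obtain ⟨hy, hyi⟩ := Finset.mem_filter.1 hy
        obtain ⟨x, hxS, rfl⟩ := (mem_coeFin S _).1 hx
        obtain ⟨y, hyS, rfl⟩ := (mem_coeFin S _).1 hy
        have ex : sumE n i (Sum.inl ⟨x, hxi⟩) = x := Fin.ext (sumE_inl ..)
        have ey : sumE n i (Sum.inl ⟨y, hyi⟩) = y := Fin.ext (sumE_inl ..)
        have := h ⟨x, hxi⟩ ⟨y, hyi⟩ (by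
          rw [Setoid.comap_rel, Setoid.comap_rel, ex, ey, toPart_rel]
          exact ⟨S, hS, hxS, hyS⟩)
        simpa using this)
  rw [rBell]
  refine Eq.trans (by convert h) ?_
  exact Nat.card_congr ((setoidCongr (sumE n i)).symm.subtypeEquiv (fun _ => Iff.rfl))

/-- Reindexing the distinguished elements. -/
def injCongr {γ δ β : Type*} (e : γ ≃ δ) :
    {u : Setoid (γ ⊕ β) // u.comap Sum.inl = ⊥} ≃ {u : Setoid (δ ⊕ β) // u.comap Sum.inl = ⊥} :=
  (setoidCongr (Equiv.sumCongr e (Equiv.refl β))).subtypeEquiv (by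
    intro u
    rw [comap_inl_eq_bot, comap_inl_eq_bot]
    constructor
    · intro h a b hab
      exact e.symm.injective (h _ _ hab)
    · intro h a b hab
      refine e.injective (h _ _ ?_)
      show u (Sum.inl (e.symm (e a))) (Sum.inl (e.symm (e b)))
      rw [e.symm_apply_apply, e.symm_apply_apply]
      exact hab)

/-- Setoids restricting to `s` are setoids on the quotient separating the classes. -/
def fiberEquiv {α β : Type*} (s : Setoid α) :
    {t : Setoid (α ⊕ β) // t.comap Sum.inl = s} ≃
      {u : Setoid (Quotient s ⊕ β) // u.comap Sum.inl = ⊥} where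
  toFun t := ⟨t.1.comap (Sum.map Quotient.out id), by
    rw [comap_inl_eq_bot]
    intro a b hab
    have h : (t.1.comap Sum.inl) a.out b.out := hab
    rw [t.2] at h
    exact Quotient.out_equiv_out.1 h⟩
  invFun u := ⟨u.1.comap (Sum.map (Quotient.mk s) id), by
    have hu := (comap_inl_eq_bot u.1).1 u.2
    ext a b
    constructor
    · intro h
      exact Quotient.exact (hu _ _ h)
    · intro h
      have e : Quotient.mk s a = Quotient.mk s b := Quotient.sound h
      show u.1 (Sum.inl (Quotient.mk s a)) (Sum.inl (Quotient.mk s b))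
      rw [e]⟩
  left_inv t := by
    have key : ∀ x : α ⊕ β, t.1 (Sum.map Quotient.out id (Sum.map (Quotient.mk s) id x)) x := by
      rintro (a | b)
      · have h : s (Quotient.mk s a).out a := Quotient.mk_out a
        have h' : (t.1.comap Sum.inl) (Quotient.mk s a).out a := by rw [t.2]; exact h
        exact h'
      · exact t.1.refl _
    apply Subtype.ext
    ext x y
    exact ⟨fun h => t.1.trans (t.1.symm (key x)) (t.1.trans h (key y)),
      fun h => t.1.trans (key x) (t.1.trans h (t.1.symm (key y)))⟩
  right_inv u := by
    have key : ∀ x : Quotient s ⊕ β, Sum.map (Quotient.mk s) id (Sum.map Quotient.out id x) = x := by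
      rintro (a | b)
      · simp
      · rfl
    apply Subtype.ext
    ext x y
    show u.1 _ _ ↔ _
    rw [key, key]

/-- `B_{n+r} = Σ_{i=1}^{r} {r,i} · B_{n,i}`. -/
theorem bell_add_eq_sum_stirling_rBell (n r : ℕ) (hr : 1 ≤ r) :
    bell (n + r) = ∑ i ∈ Finset.Icc 1 r, stirling2 r i * rBell n i := by
  rw [bell_eq_card, ← card_setoid_congr (sumE n r)]
  have h1 : Nat.card (Setoid (Fin r ⊕ Fin n)) =
      Nat.card (Σ s : Setoid (Fin r), {t : Setoid (Fin r ⊕ Fin n) // t.comap Sum.inl = s}) :=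
    Nat.card_congr (Equiv.sigmaFiberEquiv (fun t : Setoid (Fin r ⊕ Fin n) => t.comap Sum.inl)).symm
  rw [h1, Nat.card_sigma]
  have h2 : ∀ s : Setoid (Fin r),
      Nat.card {t : Setoid (Fin r ⊕ Fin n) // t.comap Sum.inl = s} =
        rBell n (Nat.card (Quotient s)) := by
    intro s
    rw [rBell_eq_card]
    exact Nat.card_congr ((fiberEquiv s).trans (injCongr (Finite.equivFin (Quotient s))))
  simp_rw [h2]
  rw [← Finset.sum_fiberwise_of_maps_to (s := Finset.univ) (t := Finset.Icc 1 r)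
    (g := fun s : Setoid (Fin r) => Nat.card (Quotient s))]
  · refine Finset.sum_congr rfl fun i _ => ?_
    rw [stirling2_eq_card, Nat.card_eq_fintype_card, Fintype.card_subtype, ← smul_eq_mul,
      ← Finset.sum_const]
    refine Finset.sum_congr rfl fun s hs => ?_
    rw [(Finset.mem_filter.1 hs).2]
  · intro s _
    rw [Finset.mem_Icc]
    constructor
    · have : Nonempty (Quotient s) := ⟨Quotient.mk s ⟨0, hr⟩⟩
      exact Nat.card_pos
    · simpa using Nat.card_le_card_of_surjective (Quotient.mk s) Quotient.mk_surjective
end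
end

section
/- Let N = {1,…,n} and let (S,P) be an embedded coalition over N with |P| = p. Then the number of partitions P' of N such that the nonempty sets among {T∖S : T ∈ P'} are exactly the blocks of P∖{S} (i.e., {T∖S : T ∈ P'} ∖ {∅} = P∖{S}) equals the r-Bell number B_{|S|, p−1}. -/
open scoped Classical
noncomputable section

/-- Membership in the image of `T` in the natural numbers (the coercion used in `rBell`). -/
theorem mem_cast {m : ℕ} (T : Finset (Fin m)) (k : ℕ) :
    k ∈ (do let a ← T; pure (a : ℕ) : Finset ℕ) ↔ ∃ a ∈ T, (a : ℕ) = k := by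
  simp only [Finset.bind_def, Finset.pure_def, Finset.mem_sup, Finset.mem_singleton, eq_comm]

/-- The collapsing map: it is injective on `S` and sends every other block to a
distinguished element. -/
theorem exists_collapse (n : ℕ) (S : Finset (Fin n))
    (P : Finset (Finset (Fin n)))
    (hne : ∀ T ∈ P, T.Nonempty)
    (hdisj : ∀ T ∈ P, ∀ T' ∈ P, T ≠ T' → Disjoint T T')
    (hcover : ∀ i : Fin n, ∃ T ∈ P, i ∈ T)
    (hS : S ∈ P) :
    ∃ ρ : Fin n → Fin (S.card + (P.card - 1)), Function.Surjective ρ ∧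
      (∀ x, (ρ x : ℕ) < P.card - 1 ↔ x ∉ S) ∧
      (∀ x ∈ S, ∀ y ∈ S, ρ x = ρ y → x = y) ∧
      (∀ B ∈ P.erase S, ∀ x ∈ B, ∀ y, ρ x = ρ y ↔ y ∈ B) := by
  have hr : (P.erase S).card = P.card - 1 := Finset.card_erase_of_mem hS
  let g := Finset.equivFinOfCardEq hr
  let e := S.equivFin
  choose bl hbl hxbl using hcover
  have huniq : ∀ T ∈ P, ∀ x ∈ T, bl x = T := by
    intro T hT x hx
    by_contra h
    exact Finset.disjoint_left.mp (hdisj _ (hbl x) _ hT h) (hxbl x) hx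
  have hmem : ∀ x, x ∉ S → bl x ∈ P.erase S := by
    intro x hx
    refine Finset.mem_erase.mpr ⟨?_, hbl x⟩
    intro h
    exact hx (h ▸ hxbl x)
  let ρ : Fin n → Fin (S.card + (P.card - 1)) := fun x =>
    if h : x ∈ S then ⟨(P.card - 1) + (e ⟨x, h⟩ : ℕ), by
      have := (e ⟨x, h⟩).2; omega⟩
    else ⟨(g ⟨bl x, hmem x h⟩ : ℕ), by have := (g ⟨bl x, hmem x h⟩).2; omega⟩
  have h1 : ∀ x (h : x ∈ S), (ρ x : ℕ) = (P.card - 1) + (e ⟨x, h⟩ : ℕ) := by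
    intro x h; simp only [ρ, dif_pos h]
  have h2 : ∀ x (h : x ∉ S), (ρ x : ℕ) = (g ⟨bl x, hmem x h⟩ : ℕ) := by
    intro x h; simp only [ρ, dif_neg h]
  have h3 : ∀ x, (ρ x : ℕ) < P.card - 1 ↔ x ∉ S := by
    intro x
    by_cases h : x ∈ S
    · rw [h1 x h]; simp [h]
    · rw [h2 x h]; simp only [h, not_false_eq_true, iff_true]
      exact (g ⟨bl x, hmem x h⟩).2
  have hout : ∀ B ∈ P.erase S, ∀ x ∈ B, x ∉ S := by
    intro B hB x hx hxS
    obtain ⟨hBS, hBP⟩ := Finset.mem_erase.mp hB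
    exact hBS ((huniq B hBP x hx).symm.trans (huniq S hS x hxS))
  refine ⟨ρ, ?_, h3, ?_, ?_⟩
  · intro a
    by_cases ha : (a : ℕ) < P.card - 1
    · obtain ⟨x, hx⟩ := hne _ (Finset.mem_of_mem_erase (g.symm ⟨a, ha⟩).2)
      have hxS := hout _ (g.symm ⟨a, ha⟩).2 x hx
      refine ⟨x, Fin.ext ?_⟩
      rw [h2 x hxS]
      have : (⟨bl x, hmem x hxS⟩ : {T // T ∈ P.erase S}) = g.symm ⟨a, ha⟩ :=
        Subtype.ext (huniq _ (Finset.mem_of_mem_erase (g.symm ⟨a, ha⟩).2) x hx)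
      rw [this, Equiv.apply_symm_apply]
    · have ha2 : (a : ℕ) - (P.card - 1) < S.card := by have := a.2; omega
      refine ⟨(e.symm ⟨_, ha2⟩).1, Fin.ext ?_⟩
      rw [h1 _ (e.symm ⟨_, ha2⟩).2]
      simp only [Subtype.coe_eta, Equiv.apply_symm_apply]
      omega
  · intro x hx y hy hxy
    have h := congrArg Fin.val hxy
    rw [h1 x hx, h1 y hy] at h
    have := e.injective (Fin.ext (Nat.add_left_cancel h))
    exact congrArg Subtype.val this
  · intro B hB x hx y
    have hxS := hout B hB x hx
    have hBP := Finset.mem_of_mem_erase hB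
    constructor
    · intro hxy
      have hyS : y ∉ S := by rw [← h3 y, ← hxy, h3 x]; exact hxS
      have h := congrArg Fin.val hxy
      rw [h2 x hxS, h2 y hyS] at h
      have := congrArg Subtype.val (g.injective (Fin.ext h))
      simp only at this
      rw [← huniq B hBP x hx, this]
      exact hxbl y
    · intro hy
      have hyS := hout B hB y hy
      apply Fin.ext
      rw [h2 x hxS, h2 y hyS]
      simp only [huniq B hBP x hx, huniq B hBP y hy]

/-- For an embedded coalition `(S,P)` over `Fin n` with `|P| = p`, the number of
partitions `P'` of the players with `{T∖S : T ∈ P'} ∖ {∅} = P ∖ {S}` equals the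
`r`-Bell number `B_{|S|, p−1}`. -/
theorem card_partitions_restricting_eq_rBell (n : ℕ) (S : Finset (Fin n))
    (P : Finset (Finset (Fin n))) (p : ℕ)
    (hne : ∀ T ∈ P, T.Nonempty)
    (hdisj : ∀ T ∈ P, ∀ T' ∈ P, T ≠ T' → Disjoint T T')
    (hcover : ∀ i : Fin n, ∃ T ∈ P, i ∈ T)
    (hS : S ∈ P) (hp : P.card = p) :
    ((partitionsF n).filter fun P' =>
        ((P'.image fun T => T \ S).erase ∅) = P.erase S).card
      = rBell S.card (p - 1) := by
  subst hp
  obtain ⟨ρ, hsurj, hlt, hinjS, hblk⟩ := exists_collapse n S P hne hdisj hcover hS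
  have hcov' : ∀ x, x ∉ S → ∃ B ∈ P.erase S, x ∈ B := by
    intro x hx
    obtain ⟨B, hB, hxB⟩ := hcover x
    exact ⟨B, Finset.mem_erase.mpr ⟨fun h => hx (h ▸ hxB), hB⟩, hxB⟩
  have hout : ∀ B ∈ P.erase S, ∀ x ∈ B, x ∉ S := by
    intro B hB x hx hxS
    obtain ⟨hBS, hBP⟩ := Finset.mem_erase.mp hB
    exact Finset.disjoint_left.mp (hdisj B hBP S hS hBS) hx hxS
  let pre : Finset (Fin (S.card + (P.card - 1))) → Finset (Fin n) :=
    fun T => Finset.univ.filter fun x => ρ x ∈ T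
  have mem_pre : ∀ T x, x ∈ pre T ↔ ρ x ∈ T := by intro T x; simp [pre]
  have pre_inj : Function.Injective pre := by
    intro T T' h
    ext a
    obtain ⟨x, rfl⟩ := hsurj a
    rw [← mem_pre, ← mem_pre, h]
  unfold rBell
  symm
  refine Finset.card_bij (fun Q _ => Q.image pre) ?_ ?_ ?_
  · intro Q hQ
    simp only [partitionsF, Finset.mem_filter, Finset.mem_univ, true_and] at hQ ⊢
    obtain ⟨⟨q1, q2, q3⟩, q4⟩ := hQ
    -- the trace of a block outside `S`
    have key : ∀ T ∈ Q, ∀ B ∈ P.erase S, ∀ x ∈ B, ρ x ∈ T → pre T \ S = B := by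
      intro T hT B hB x hxB hxT
      ext y
      rw [Finset.mem_sdiff, mem_pre]
      constructor
      · rintro ⟨hy, hyS⟩
        rw [← hblk B hB x hxB y]
        apply Fin.ext
        refine Finset.card_le_one.mp (q4 T hT) _ ?_ _ ?_
        · exact Finset.mem_filter.mpr
            ⟨(mem_cast T _).mpr ⟨_, hxT, rfl⟩, (hlt x).mpr (hout B hB x hxB)⟩
        · exact Finset.mem_filter.mpr ⟨(mem_cast T _).mpr ⟨_, hy, rfl⟩, (hlt y).mpr hyS⟩
      · intro hy
        exact ⟨(hblk B hB x hxB y).mpr hy ▸ hxT, hout B hB y hy⟩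
    refine ⟨⟨?_, ?_, ?_⟩, ?_⟩
    · intro U hU
      obtain ⟨T, hT, rfl⟩ := Finset.mem_image.mp hU
      obtain ⟨a, ha⟩ := q1 T hT
      obtain ⟨x, rfl⟩ := hsurj a
      exact ⟨x, (mem_pre T x).mpr ha⟩
    · intro U hU U' hU' hUU
      obtain ⟨T, hT, rfl⟩ := Finset.mem_image.mp hU
      obtain ⟨T', hT', rfl⟩ := Finset.mem_image.mp hU'
      have hTT : T ≠ T' := fun h => hUU (by rw [h])
      rw [Finset.disjoint_left]
      intro x hx hx'
      exact Finset.disjoint_left.mp (q2 T hT T' hT' hTT)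
        ((mem_pre T x).mp hx) ((mem_pre T' x).mp hx')
    · intro x
      obtain ⟨T, hT, hx⟩ := q3 (ρ x)
      exact ⟨pre T, Finset.mem_image_of_mem _ hT, (mem_pre T x).mpr hx⟩
    · ext B
      constructor
      · intro hB
        obtain ⟨hB0, hB⟩ := Finset.mem_erase.mp hB
        obtain ⟨U, hU, rfl⟩ := Finset.mem_image.mp hB
        obtain ⟨T, hT, rfl⟩ := Finset.mem_image.mp hU
        obtain ⟨x, hx⟩ := Finset.nonempty_iff_ne_empty.mpr hB0
        obtain ⟨hxT, hxS⟩ := Finset.mem_sdiff.mp hx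
        obtain ⟨C, hC, hxC⟩ := hcov' x hxS
        have := key T hT C hC x hxC ((mem_pre T x).mp hxT)
        simp only [this]
        exact hC
      · intro hB
        obtain ⟨x, hx⟩ := hne B (Finset.mem_of_mem_erase hB)
        obtain ⟨T, hT, hxT⟩ := q3 (ρ x)
        refine Finset.mem_erase.mpr ⟨Finset.nonempty_iff_ne_empty.mp ⟨x, hx⟩, ?_⟩
        exact Finset.mem_image.mpr
          ⟨pre T, Finset.mem_image_of_mem _ hT, key T hT B hB x hx hxT⟩
  · intro Q _ Q' _ h
    exact Finset.image_injective pre_inj h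
  · intro P' hP'
    simp only [partitionsF, Finset.mem_filter, Finset.mem_univ, true_and] at hP'
    obtain ⟨⟨p1, p2, p3⟩, p4⟩ := hP'
    have hblock : ∀ T ∈ P', ∀ x ∈ T, x ∉ S → T \ S ∈ P.erase S := by
      intro T hT x hx hxS
      rw [← p4]
      refine Finset.mem_erase.mpr ⟨?_, Finset.mem_image.mpr ⟨T, hT, rfl⟩⟩
      exact Finset.nonempty_iff_ne_empty.mp ⟨x, Finset.mem_sdiff.mpr ⟨hx, hxS⟩⟩
    have hsat : ∀ T ∈ P', ∀ x ∈ T, ∀ y, ρ x = ρ y → y ∈ T := by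
      intro T hT x hx y hxy
      by_cases hxS : x ∈ S
      · have hyS : y ∈ S := by
          by_contra h
          have := (hlt y).mpr h
          rw [← hxy] at this
          exact (hlt x).mp this hxS
        exact hinjS x hxS y hyS hxy ▸ hx
      · have hB := hblock T hT x hx hxS
        have := (hblk _ hB x (Finset.mem_sdiff.mpr ⟨hx, hxS⟩) y).mp hxy
        exact (Finset.mem_sdiff.mp this).1
    have hpre : ∀ T ∈ P', pre (T.image ρ) = T := by
      intro T hT
      ext y
      rw [mem_pre]
      constructor
      · intro h
        obtain ⟨x, hx, hxy⟩ := Finset.mem_image.mp h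
        exact hsat T hT x hx y hxy
      · exact fun h => Finset.mem_image_of_mem _ h
    refine ⟨P'.image fun T => T.image ρ, ?_, ?_⟩
    · simp only [partitionsF, Finset.mem_filter, Finset.mem_univ, true_and]
      refine ⟨⟨?_, ?_, ?_⟩, ?_⟩
      · intro U hU
        obtain ⟨T, hT, rfl⟩ := Finset.mem_image.mp hU
        exact (p1 T hT).image ρ
      · intro U hU U' hU' hUU
        obtain ⟨T, hT, rfl⟩ := Finset.mem_image.mp hU
        obtain ⟨T', hT', rfl⟩ := Finset.mem_image.mp hU'
        have hTT : T ≠ T' := fun h => hUU (by rw [h])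
        rw [Finset.disjoint_left]
        intro a ha ha'
        obtain ⟨x, hx, rfl⟩ := Finset.mem_image.mp ha
        obtain ⟨y, hy, hyx⟩ := Finset.mem_image.mp ha'
        exact Finset.disjoint_left.mp (p2 T hT T' hT' hTT) hx (hsat T' hT' y hy x hyx)
      · intro a
        obtain ⟨x, rfl⟩ := hsurj a
        obtain ⟨T, hT, hx⟩ := p3 x
        exact ⟨T.image ρ, Finset.mem_image.mpr ⟨T, hT, rfl⟩, Finset.mem_image_of_mem _ hx⟩
      · intro U hU
        obtain ⟨T, hT, rfl⟩ := Finset.mem_image.mp hU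
        rw [Finset.card_le_one]
        intro a ha b hb
        obtain ⟨ha, ha'⟩ := Finset.mem_filter.mp ha
        obtain ⟨hb, hb'⟩ := Finset.mem_filter.mp hb
        obtain ⟨a, ha2, rfl⟩ := (mem_cast _ _).mp ha
        obtain ⟨b, hb2, rfl⟩ := (mem_cast _ _).mp hb
        obtain ⟨x, hx, rfl⟩ := Finset.mem_image.mp ha2
        obtain ⟨y, hy, rfl⟩ := Finset.mem_image.mp hb2
        have hxS := (hlt x).mp ha'
        have hyS := (hlt y).mp hb'
        refine congrArg Fin.val ?_
        exact (hblk _ (hblock T hT x hx hxS) x (Finset.mem_sdiff.mpr ⟨hx, hxS⟩) y).mpr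
          (Finset.mem_sdiff.mpr ⟨hy, hyS⟩)
    · ext T
      constructor
      · intro h
        obtain ⟨U, hU, rfl⟩ := Finset.mem_image.mp h
        obtain ⟨T, hT, rfl⟩ := Finset.mem_image.mp hU
        simp only [hpre T hT]
        exact hT
      · intro hT
        exact Finset.mem_image.mpr ⟨T.image ρ, Finset.mem_image.mpr ⟨T, hT, rfl⟩, hpre T hT⟩
end
end

section
/- Let G be a finite simple graph on k vertices and let m ≥ 0. The number of proper colorings f : V(G) → {1,…,m} equals Σ_{i=1}^{k} m·(m−1)···(m−i+1) · p_i, where p_i is the number of partitions of V(G) into exactly i nonempty independent sets and the falling factorial m·(m−1)···(m−i+1) is 0 when i > m. -/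
open scoped Classical
noncomputable section

/-- The partition of the vertex set into the nonempty fibers of `f`. -/
def kerPart {k m : ℕ} (f : Fin k → Fin m) : Finset (Finset (Fin k)) :=
  Finset.univ.image fun v => Finset.univ.filter fun u => f u = f v

theorem kerPart_mem {k m : ℕ} (f : Fin k → Fin m) : kerPart f ∈ partitionsF k := by
  simp only [partitionsF, kerPart, Finset.mem_filter, Finset.mem_univ, true_and,
    Finset.mem_image]
  refine ⟨?_, ?_, ?_⟩
  · rintro S ⟨v, rfl⟩
    exact ⟨v, by simp⟩
  · rintro S ⟨v, rfl⟩ T ⟨w, rfl⟩ hne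
    rw [Finset.disjoint_left]
    intro u hu hu'
    simp only [Finset.mem_filter, Finset.mem_univ, true_and] at hu hu'
    exact hne (by rw [← hu, ← hu'])
  · intro i
    exact ⟨_, ⟨i, rfl⟩, by simp⟩

theorem exists_block {k : ℕ} {Q : Finset (Finset (Fin k))} (hQ : Q ∈ partitionsF k) :
    ∃ b : Fin k → Q, Function.Surjective b ∧ ∀ (v : Fin k) (S : Q), v ∈ S.1 ↔ b v = S := by
  simp only [partitionsF, Finset.mem_filter, Finset.mem_univ, true_and] at hQ
  obtain ⟨h1, h2, h3⟩ := hQ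
  choose b hb hvb using h3
  have key : ∀ (v : Fin k) (S : Q), v ∈ S.1 ↔ (⟨b v, hb v⟩ : Q) = S := by
    intro v S
    constructor
    · intro hv
      apply Subtype.ext
      by_contra hne
      exact Finset.disjoint_left.1 (h2 _ (hb v) _ S.2 hne) (hvb v) hv
    · rintro rfl
      exact hvb v
  refine ⟨fun v => ⟨b v, hb v⟩, ?_, key⟩
  intro S
  obtain ⟨v, hv⟩ := h1 S.1 S.2
  exact ⟨v, (key v S).1 hv⟩

theorem card_fiber {k m : ℕ} {Q : Finset (Finset (Fin k))} (hQ : Q ∈ partitionsF k) :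
    ((Finset.univ : Finset (Fin k → Fin m)).filter fun f => kerPart f = Q).card
      = m.descFactorial Q.card := by
  obtain ⟨b, hs, hb⟩ := exists_block hQ
  have hc : Fintype.card (Q ↪ Fin m) = m.descFactorial Q.card := by
    rw [Fintype.card_embedding_eq]; simp
  rw [← hc, ← Finset.card_univ]
  symm
  refine Finset.card_bij (fun e _ => fun v => e (b v)) ?_ ?_ ?_
  · intro e _
    refine Finset.mem_filter.2 ⟨Finset.mem_univ _, ?_⟩
    unfold kerPart
    have hfil : ∀ v, (Finset.univ.filter fun u => e (b u) = e (b v)) = (b v).1 := by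
      intro v
      ext u
      simp [hb u (b v)]
    ext S
    simp only [Finset.mem_image, Finset.mem_univ, true_and, hfil]
    constructor
    · rintro ⟨v, rfl⟩
      exact (b v).2
    · intro hS
      obtain ⟨v, hv⟩ := hs ⟨S, hS⟩
      exact ⟨v, by rw [hv]⟩
  · intro e _ e' _ h
    ext S
    obtain ⟨v, rfl⟩ := hs S
    exact congrArg Fin.val (congrFun h v)
  · intro f hf
    simp only [Finset.mem_filter, Finset.mem_univ, true_and] at hf
    have hiff : ∀ u v, f u = f v ↔ b u = b v := by
      intro u v
      have hm : (Finset.univ.filter fun w => f w = f v) ∈ Q := by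
        rw [← hf]
        exact Finset.mem_image_of_mem _ (Finset.mem_univ v)
      have hv := (hb v ⟨_, hm⟩).1 (by simp)
      rw [hv, ← hb u]
      simp
    choose r hr using hs
    refine ⟨⟨fun S => f (r S), ?_⟩, Finset.mem_univ _, ?_⟩
    · intro S T h
      have := (hiff _ _).1 h
      rwa [hr, hr] at this
    · funext v
      exact (hiff _ _).2 (hr _)

theorem proper_iff {k m : ℕ} (G : SimpleGraph (Fin k)) (f : Fin k → Fin m) :
    (∀ u v, G.Adj u v → f u ≠ f v) ↔
      ∀ B ∈ kerPart f, ∀ u ∈ B, ∀ v ∈ B, ¬ G.Adj u v := by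
  simp only [kerPart, Finset.mem_image, Finset.mem_univ, true_and]
  constructor
  · rintro h B ⟨w, rfl⟩ u hu v hv ha
    simp only [Finset.mem_filter, Finset.mem_univ, true_and] at hu hv
    exact h u v ha (hu.trans hv.symm)
  · intro h u v ha he
    exact h _ ⟨v, rfl⟩ u (by simp [he]) v (by simp) ha

/-- The number of proper colorings of a graph `G` on `k ≥ 1` vertices with colors
`{1,…,m}` equals `Σ_{i=1}^{k} m·(m−1)⋯(m−i+1) · p_i`, where `p_i` is the number of
partitions of the vertex set into exactly `i` nonempty independent sets. -/
theorem card_colorings_eq_sum_indep_partitions (k m : ℕ) (hk : 0 < k)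
    (G : SimpleGraph (Fin k)) :
    ((Finset.univ : Finset (Fin k → Fin m)).filter fun f =>
        ∀ u v, G.Adj u v → f u ≠ f v).card
      = ∑ i ∈ Finset.Icc 1 k,
          (∏ j ∈ Finset.range i, (m - j)) *
            ((partitionsF k).filter fun Q => Q.card = i ∧
                ∀ B ∈ Q, ∀ u ∈ B, ∀ v ∈ B, ¬ G.Adj u v).card := by
  have hprod : ∀ i, (∏ j ∈ Finset.range i, (m - j)) = m.descFactorial i := fun i =>
    (Nat.descFactorial_eq_prod_range m i).symm
  set I := (partitionsF k).filter fun Q => ∀ B ∈ Q, ∀ u ∈ B, ∀ v ∈ B, ¬ G.Adj u v with hI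
  have hL : ((Finset.univ : Finset (Fin k → Fin m)).filter fun f =>
        ∀ u v, G.Adj u v → f u ≠ f v).card = ∑ Q ∈ I, m.descFactorial Q.card := by
    rw [Finset.card_eq_sum_card_fiberwise (f := kerPart) (t := I)]
    · refine Finset.sum_congr rfl fun Q hQ => ?_
      rw [hI, Finset.mem_filter] at hQ
      rw [← card_fiber hQ.1, Finset.filter_filter]
      congr 1
      ext f
      simp only [Finset.mem_filter, Finset.mem_univ, true_and, and_iff_right_iff_imp]
      rintro rfl
      exact (proper_iff G f).2 hQ.2
    · intro f hf
      have hf' := (Finset.mem_filter.1 (Finset.mem_coe.1 hf)).2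
      exact Finset.mem_coe.2 (Finset.mem_filter.2 ⟨kerPart_mem f, (proper_iff G f).1 hf'⟩)
  have hmaps : ∀ Q ∈ I, Q.card ∈ Finset.Icc 1 k := by
    intro Q hQ
    obtain ⟨b, hs, _⟩ := exists_block (Finset.mem_filter.1 hQ).1
    rw [Finset.mem_Icc]
    constructor
    · exact Finset.card_pos.2 ⟨(b ⟨0, hk⟩).1, (b ⟨0, hk⟩).2⟩
    · simpa using Fintype.card_le_of_surjective b hs
  rw [hL, ← Finset.sum_fiberwise_of_maps_to hmaps]
  refine Finset.sum_congr rfl fun i _ => ?_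
  have hfil : ((partitionsF k).filter fun Q => Q.card = i ∧
      ∀ B ∈ Q, ∀ u ∈ B, ∀ v ∈ B, ¬ G.Adj u v) = I.filter fun Q => Q.card = i := by
    ext Q
    simp only [hI, Finset.mem_filter]
    tauto
  rw [hfil, hprod, Finset.sum_congr rfl
    (g := fun _ => m.descFactorial i) (fun Q hQ => by rw [(Finset.mem_filter.1 hQ).2])]
  rw [Finset.sum_const, smul_eq_mul, mul_comm]
end
end

section
/- For every k ≥ 0, the determinant of the (k+1)×(k+1) matrix with rows and columns indexed by 0 ≤ j, m ≤ k and (j,m) entry (m+j)! · (k−m)! equals ∏_{i=0}^{k} (i!)^3. -/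
lemma choose_add_sum (k j m : ℕ) (hj : j ≤ k) :
    (m + j).choose j = ∑ i ∈ Finset.range (k + 1), j.choose i * m.choose i := by
  rw [Nat.add_choose_eq, Finset.Nat.sum_antidiagonal_eq_sum_range_succ_mk]
  have hsub : Finset.range (j + 1) ⊆ Finset.range (k + 1) :=
    Finset.range_subset_range.2 (by omega)
  rw [← Finset.sum_subset hsub]
  · refine Finset.sum_congr rfl fun i hi => ?_
    have : i ≤ j := by simpa [Nat.lt_succ_iff] using hi
    simp only [Nat.choose_symm this]
    ring
  · intro i _ hi
    have : j < i := by simp at hi; omega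
    simp [Nat.choose_eq_zero_of_lt this]

/-- The determinant of the `(k+1)×(k+1)` matrix with rows and columns indexed by
`0 ≤ j, m ≤ k` and `(j,m)` entry `(m+j)!·(k−m)!` equals `∏_{i=0}^{k} (i!)^3`. -/
theorem det_factorial_matrix (k : ℕ) :
    (Matrix.of fun j m : Fin (k + 1) =>
        (((m.val + j.val).factorial * (k - m.val).factorial : ℕ) : ℤ)).det
      = ∏ i ∈ Finset.range (k + 1), ((i.factorial : ℤ)) ^ 3 := by
  let L : Matrix (Fin (k + 1)) (Fin (k + 1)) ℤ :=
    Matrix.of fun j i => ((j.val.choose i.val : ℕ) : ℤ)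
  have hL : L.det = 1 := by
    rw [Matrix.det_of_lowerTriangular]
    · simp [L]
    · intro a b hab
      have : a < b := hab
      simp only [L, Matrix.of_apply]
      rw [Nat.choose_eq_zero_of_lt (by exact this)]
      rfl
  have hM : (Matrix.of fun j m : Fin (k + 1) =>
        (((m.val + j.val).factorial * (k - m.val).factorial : ℕ) : ℤ))
      = Matrix.diagonal (fun j : Fin (k + 1) => (j.val.factorial : ℤ)) * (L * L.transpose) *
        Matrix.diagonal (fun m : Fin (k + 1) =>
          ((m.val.factorial : ℤ) * ((k - m.val).factorial : ℤ))) := by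
    ext j m
    rw [Matrix.mul_diagonal, Matrix.diagonal_mul, Matrix.mul_apply]
    simp only [L, Matrix.of_apply, Matrix.transpose_apply]
    have h1 := choose_add_sum k j.val m.val (by omega)
    rw [← Fin.sum_univ_eq_sum_range (fun i => j.val.choose i * m.val.choose i)] at h1
    have h2 := Nat.add_choose_mul_factorial_mul_factorial m.val j.val
    rw [h1] at h2
    rw [← h2]
    push_cast
    ring
  have h3 : ∏ m : Fin (k + 1), ((k - m.val).factorial : ℤ)
      = ∏ i ∈ Finset.range (k + 1), (i.factorial : ℤ) := by
    rw [Fin.prod_univ_eq_prod_range (fun i => ((k - i).factorial : ℤ)),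
      ← Finset.prod_range_reflect (fun i => (i.factorial : ℤ))]
    simp
  rw [hM, Matrix.det_mul, Matrix.det_mul, Matrix.det_mul, Matrix.det_transpose, hL,
    Matrix.det_diagonal, Matrix.det_diagonal, Finset.prod_mul_distrib, h3,
    Fin.prod_univ_eq_prod_range (fun i => (i.factorial : ℤ)), Finset.prod_pow]
  ring
end

section
/- For every k ≥ 1, the determinant of the k×k matrix with (j,m) entry (k−m)! · B_{j,m} (for 1 ≤ j, m ≤ k), where B_{j,m} is the r-Bell number, equals (∏_{i=0}^{k−1} i!) · (∏_{i=0}^{k} i!) · (Σ_{i=0}^{k} 1/i!), the computation being carried out over the rationals. -/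
open scoped Classical
noncomputable section

namespace RBellAux

/-- Setoids on `Fin N` separating the elements below `r`. -/
def Sep (N r : ℕ) (s : Setoid (Fin N)) : Prop :=
  ∀ a b : Fin N, a.val < r → b.val < r → s a b → a = b

instance finiteSetoid (N : ℕ) : Finite (Setoid (Fin N)) :=
  Finite.of_injective (fun s : Setoid (Fin N) => fun a b => s a b) (by
    intro s t h
    ext a b
    exact iff_of_eq (congrFun (congrFun h a) b))

def cnt (N r : ℕ) : ℕ := Nat.card {s : Setoid (Fin N) // Sep N r s}

def toPart {N : ℕ} (s : Setoid (Fin N)) : Finset (Finset (Fin N)) :=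
  Finset.univ.image fun x => Finset.univ.filter fun y => s x y

lemma toPart_inj {N : ℕ} {s t : Setoid (Fin N)} (h : toPart s = toPart t) : s = t := by
  have key : ∀ {s t : Setoid (Fin N)}, toPart s = toPart t → ∀ x y, s x y → t x y := by
    intro s t h x y hxy
    have : (Finset.univ.filter fun y => s x y) ∈ toPart t := by
      rw [← h]; exact Finset.mem_image_of_mem _ (Finset.mem_univ _)
    obtain ⟨z, -, hz⟩ := Finset.mem_image.1 this
    have h1 : x ∈ Finset.univ.filter fun y => t z y := by
      rw [hz]; simpa using s.refl' x
    have h2 : y ∈ Finset.univ.filter fun y => t z y := by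
      rw [hz]; simpa using hxy
    have h1' : t z x := by simpa using h1
    have h2' : t z y := by simpa using h2
    exact t.trans' (t.symm' h1') h2'
  ext x y
  exact ⟨key h x y, key h.symm x y⟩

lemma toPart_mem {N : ℕ} (s : Setoid (Fin N)) : toPart s ∈ partitionsF N := by
  unfold partitionsF
  refine Finset.mem_filter.2 ⟨Finset.mem_univ _, ?_, ?_, ?_⟩
  · intro S hS
    obtain ⟨x, -, rfl⟩ := Finset.mem_image.1 hS
    exact ⟨x, by simpa using s.refl' x⟩
  · intro S hS T hT hne
    obtain ⟨x, -, rfl⟩ := Finset.mem_image.1 hS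
    obtain ⟨y, -, rfl⟩ := Finset.mem_image.1 hT
    rw [Finset.disjoint_left]
    intro z hz hz'
    have h1 : s x z := by simpa using hz
    have h2 : s y z := by simpa using hz'
    apply hne
    ext w
    simp only [Finset.mem_filter, Finset.mem_univ, true_and]
    exact ⟨fun h => s.trans' h2 (s.trans' (s.symm' h1) h),
      fun h => s.trans' h1 (s.trans' (s.symm' h2) h)⟩
  · intro i
    exact ⟨_, Finset.mem_image_of_mem _ (Finset.mem_univ i), by simpa using s.refl' i⟩

lemma toPart_surj {N : ℕ} {P : Finset (Finset (Fin N))} (hP : P ∈ partitionsF N) :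
    ∃ s : Setoid (Fin N), toPart s = P := by
  obtain ⟨-, h1, h2, h3⟩ := Finset.mem_filter.1 hP
  have huniq : ∀ S ∈ P, ∀ T ∈ P, ∀ x, x ∈ S → x ∈ T → S = T := by
    intro S hS T hT x hx hx'
    by_contra hne
    exact Finset.disjoint_left.1 (h2 S hS T hT hne) hx hx'
  let s : Setoid (Fin N) :=
    { r := fun x y => ∃ S ∈ P, x ∈ S ∧ y ∈ S
      iseqv :=
        ⟨fun x => by obtain ⟨S, hS, hx⟩ := h3 x; exact ⟨S, hS, hx, hx⟩,
         fun {x y} ⟨S, hS, hx, hy⟩ => ⟨S, hS, hy, hx⟩,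
         fun {x y z} ⟨S, hS, hx, hy⟩ ⟨T, hT, hy', hz⟩ => by
          have := huniq S hS T hT y hy hy'
          subst this
          exact ⟨S, hS, hx, hz⟩⟩ }
  have hcl : ∀ S ∈ P, ∀ x ∈ S, (Finset.univ.filter fun y => s x y) = S := by
    intro S hS x hx
    ext y
    simp only [Finset.mem_filter, Finset.mem_univ, true_and]
    constructor
    · rintro ⟨T, hT, hx', hy⟩
      rwa [huniq S hS T hT x hx hx']
    · intro hy
      exact ⟨S, hS, hx, hy⟩
  refine ⟨s, ?_⟩
  ext S
  constructor
  · intro hS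
    obtain ⟨x, -, rfl⟩ := Finset.mem_image.1 hS
    obtain ⟨T, hT, hx⟩ := h3 x
    rw [hcl T hT x hx]; exact hT
  · intro hS
    obtain ⟨x, hx⟩ := h1 S hS
    rw [← hcl S hS x hx]
    exact Finset.mem_image_of_mem _ (Finset.mem_univ _)

lemma sep_iff {N r : ℕ} (s : Setoid (Fin N)) :
    (∀ S ∈ toPart s, (S.filter fun i => (i : ℕ) < r).card ≤ 1) ↔ Sep N r s := by
  constructor
  · intro h a b ha hb hab
    have := h _ (Finset.mem_image_of_mem _ (Finset.mem_univ a))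
    rw [Finset.card_le_one] at this
    apply Fin.ext
    apply this
    · refine Finset.mem_filter.2 ⟨?_, ha⟩
      simp only [Finset.bind_def, Finset.pure_def, Finset.mem_sup, Finset.mem_singleton]
      exact ⟨a, by simp, rfl⟩
    · refine Finset.mem_filter.2 ⟨?_, hb⟩
      simp only [Finset.bind_def, Finset.pure_def, Finset.mem_sup, Finset.mem_singleton]
      exact ⟨b, by simpa using hab, rfl⟩
  · intro h S hS
    obtain ⟨x, -, rfl⟩ := Finset.mem_image.1 hS
    rw [Finset.card_le_one]
    intro a ha b hb
    simp only [Finset.bind_def, Finset.pure_def, Finset.mem_sup, Finset.mem_singleton,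
      Finset.mem_filter, Finset.mem_univ, true_and] at ha hb
    obtain ⟨⟨a, ha, rfl⟩, ha'⟩ := ha
    obtain ⟨⟨b, hb, rfl⟩, hb'⟩ := hb
    exact congrArg Fin.val (h a b ha' hb' (s.trans' (s.symm' ha) hb))

lemma rBell_eq_cnt (m r : ℕ) : rBell m r = cnt (m + r) r := by
  unfold rBell cnt
  rw [← Fintype.card_coe, ← Nat.card_eq_fintype_card]
  symm
  refine Nat.card_eq_of_bijective
    (fun s => ⟨toPart s.1, Finset.mem_filter.2 ⟨toPart_mem s.1, (sep_iff s.1).2 s.2⟩⟩) ⟨?_, ?_⟩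
  · intro s t h
    exact Subtype.ext (toPart_inj (congrArg Subtype.val h))
  · rintro ⟨P, hP⟩
    obtain ⟨h1, h2⟩ := Finset.mem_filter.1 hP
    obtain ⟨s, rfl⟩ := toPart_surj h1
    exact ⟨⟨s, (sep_iff s).1 h2⟩, rfl⟩

lemma cnt_self (r : ℕ) : cnt r r = 1 := by
  unfold cnt
  rw [Nat.card_eq_one_iff_unique]
  refine ⟨⟨?_⟩, ⟨⟨⊥, ?_⟩⟩⟩
  · have key : ∀ s : Setoid (Fin r), Sep r r s → s = ⊥ := by
      intro s hs
      refine le_antisymm ?_ bot_le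
      intro a b hab
      exact hs a b a.2 b.2 hab
    rintro ⟨s, hs⟩ ⟨t, ht⟩
    exact Subtype.ext ((key s hs).trans (key t ht).symm)
  · intro a b _ _ h
    exact h

lemma val_succAbove_lt {N r : ℕ} (hr : r < N + 1) (x : Fin N) (hx : x.val < r) :
    ((⟨r, hr⟩ : Fin (N+1)).succAbove x).val = x.val := by
  rw [Fin.succAbove_of_castSucc_lt]
  · rfl
  · exact hx

lemma cnt_rec (N r : ℕ) (hr : r ≤ N) : cnt (N+1) r = cnt (N+1) (r+1) + r * cnt N r := by
  have hr' : r < N + 1 := by omega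
  let p : Fin (N+1) := ⟨r, hr'⟩
  let e : Fin r → Fin N := fun a => ⟨a.val, by omega⟩
  let g : Fin r → Fin (N+1) → Fin N := fun a => Fin.insertNth (α := fun _ => Fin N) p (e a) id
  have gp : ∀ a, g a p = e a := fun a => by simp [g]
  have gs : ∀ a x, g a (p.succAbove x) = x := fun a x => by simp [g]
  have vs : ∀ x : Fin N, x.val < r → (p.succAbove x).val = x.val :=
    fun x hx => val_succAbove_lt hr' x hx
  have lift : ∀ x : Fin (N+1), x.val < r → ∃ y : Fin N, y.val < r ∧ p.succAbove y = x := by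
    intro x hx
    refine ⟨⟨x.val, by omega⟩, hx, ?_⟩
    apply Fin.ext
    rw [vs _ hx]
  have hsep : ∀ a s, Sep N r s → Sep (N+1) r (s.comap (g a)) := by
    intro a s hs x y hx hy hxy
    obtain ⟨x, hx1, rfl⟩ := lift x hx
    obtain ⟨y, hy1, rfl⟩ := lift y hy
    have : s (g a (p.succAbove x)) (g a (p.succAbove y)) := hxy
    rw [gs, gs] at this
    rw [hs x y hx1 hy1 this]
  let F : {s : Setoid (Fin (N+1)) // Sep (N+1) (r+1) s} ⊕
      (Fin r × {s : Setoid (Fin N) // Sep N r s}) → {s : Setoid (Fin (N+1)) // Sep (N+1) r s} :=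
    Sum.elim (fun s => ⟨s.1, fun a b ha hb => s.2 a b (by omega) (by omega)⟩)
      (fun q => ⟨q.2.1.comap (g q.1), hsep _ _ q.2.2⟩)
  have hrel : ∀ a (s : Setoid (Fin N)), (s.comap (g a)) p (p.succAbove (e a)) := by
    intro a s
    change s (g a p) (g a (p.succAbove (e a)))
    rw [gp, gs]
  have hne : ∀ (s : Setoid (Fin (N+1))) (t : Setoid (Fin N)) a, Sep (N+1) (r+1) s →
      s ≠ t.comap (g a) := by
    rintro s t a hs rfl
    have := hs p (p.succAbove (e a)) (Nat.lt_succ_self r)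
      (by rw [vs _ a.2]; exact Nat.lt_succ_of_lt a.2) (hrel a t)
    exact Fin.succAbove_ne p (e a) this.symm
  have hF : Function.Bijective F := by
    constructor
    · rintro (⟨s, hs⟩ | ⟨a, s, hs⟩) (⟨t, ht⟩ | ⟨b, t, ht⟩) h
      · have : s = t := congrArg Subtype.val h
        subst this; rfl
      · exact absurd (congrArg Subtype.val h) (hne s t b hs)
      · exact absurd (congrArg Subtype.val h).symm (hne t s a ht)
      · have h' : s.comap (g a) = t.comap (g b) := congrArg Subtype.val h
        have hst : s = t := by
          ext x y
          have h1 : (s.comap (g a)) (p.succAbove x) (p.succAbove y) ↔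
            (t.comap (g b)) (p.succAbove x) (p.succAbove y) := by rw [h']
          change s (g a _) (g a _) ↔ t (g b _) (g b _) at h1
          rwa [gs, gs, gs, gs] at h1
        have hab : a = b := by
          have h1 := hrel a s
          rw [h'] at h1
          change t (g b p) (g b _) at h1
          rw [gp, gs] at h1
          have h2 := ht _ _ b.2 a.2 h1
          exact Fin.ext (congrArg Fin.val h2).symm
        subst hst; subst hab; rfl
    · rintro ⟨s, hs⟩
      by_cases h : ∃ a : Fin r, s p (p.succAbove (e a))
      · obtain ⟨a, ha⟩ := h
        refine ⟨Sum.inr ⟨a, s.comap p.succAbove, ?_⟩, ?_⟩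
        · intro x y hx hy hxy
          exact Fin.succAbove_right_injective
            (hs _ _ (by rw [vs _ hx]; exact hx) (by rw [vs _ hy]; exact hy) hxy)
        · apply Subtype.ext
          have key : ∀ x, s x (p.succAbove (g a x)) := by
            intro x
            rcases Fin.eq_self_or_eq_succAbove p x with rfl | ⟨y, rfl⟩
            · rw [gp]; exact ha
            · rw [gs]
          change (s.comap p.succAbove).comap (g a) = s
          ext x y
          change s (p.succAbove (g a x)) (p.succAbove (g a y)) ↔ s x y
          exact ⟨fun h => s.trans' (key x) (s.trans' h (s.symm' (key y))),
            fun h => s.trans' (s.symm' (key x)) (s.trans' h (key y))⟩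
      · refine ⟨Sum.inl ⟨s, ?_⟩, rfl⟩
        have hp : ∀ x : Fin (N+1), x.val < r → ¬ s p x := by
          intro x hx hpx
          obtain ⟨y, hy, rfl⟩ := lift x hx
          exact h ⟨⟨y.val, hy⟩, hpx⟩
        intro x y hx hy hxy
        rcases Nat.lt_succ_iff_lt_or_eq.1 hx with hx | hx <;>
        rcases Nat.lt_succ_iff_lt_or_eq.1 hy with hy | hy
        · exact hs x y hx hy hxy
        · have : y = p := Fin.ext hy
          subst this
          exact absurd (s.symm' hxy) (hp x hx)
        · have : x = p := Fin.ext hx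
          subst this
          exact absurd hxy (hp y hy)
        · exact Fin.ext (hx.trans hy.symm)
  unfold cnt
  rw [← Nat.card_eq_of_bijective F hF, Nat.card_sum, Nat.card_prod, Nat.card_fin]

lemma rBell_zero (r : ℕ) : rBell 0 r = 1 := by
  rw [rBell_eq_cnt, Nat.zero_add, cnt_self]

lemma rBell_succ (n r : ℕ) : rBell (n+1) r = rBell n (r+1) + r * rBell n r := by
  rw [rBell_eq_cnt, rBell_eq_cnt, rBell_eq_cnt]
  have h1 : n + 1 + r = (n + r) + 1 := by omega
  have h2 : n + (r + 1) = (n + r) + 1 := by omega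
  rw [h1, h2]
  exact cnt_rec (n+r) r (by omega)

/-- Newton coefficients of `m ↦ rBell j m`. -/
def G : ℕ → ℕ → ℚ
  | 0, 0 => 1
  | 0, _ + 1 => 0
  | j + 1, 0 => G j 0 + G j 1
  | j + 1, i + 1 => (i + 2) * G j (i+1) + (i + 2) * G j (i+2) + G j i

lemma G_gt (j : ℕ) : ∀ i, j < i → G j i = 0 := by
  induction j with
  | zero => intro i hi; obtain ⟨i, rfl⟩ := Nat.exists_eq_succ_of_ne_zero hi.ne'; simp [G]
  | succ j ih =>
    intro i hi
    obtain ⟨i, rfl⟩ := Nat.exists_eq_succ_of_ne_zero (show i ≠ 0 by omega)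
    simp [G, ih (i+1) (by omega), ih (i+2) (by omega), ih i (by omega)]

lemma G_diag (j : ℕ) : G j j = 1 := by
  induction j with
  | zero => simp [G]
  | succ j ih => simp [G, ih, G_gt j (j+1) (by omega), G_gt j (j+2) (by omega)]

/-- Rearrangement of a weighted sum of `G (j+1)`. -/
lemma G_sum (w : ℕ → ℚ) (j : ℕ) (n : ℕ) (hn : j < n) :
    ∑ i ∈ Finset.range (n+1), G (j+1) i * w i
      = ∑ i ∈ Finset.range n, G j i * ((i+1) * w i + i * w (i-1) + w (i+1)) := by
  have h1 : ∀ n, ∑ i ∈ Finset.range (n+1), G (j+1) i * w i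
      = ∑ i ∈ Finset.range n, G j i * ((i+1) * w i + i * w (i-1) + w (i+1))
        + (n+1) * G j n * w n + n * G j n * w (n-1) + (n+1) * G j (n+1) * w n := by
    intro n
    induction n with
    | zero => simp [G]; ring
    | succ n ih =>
      rw [Finset.sum_range_succ, ih, Finset.sum_range_succ]
      simp only [G, Nat.add_sub_cancel]
      push_cast
      ring
  rw [h1, G_gt j n hn, G_gt j (n+1) (by omega)]
  ring

lemma G_alt (j n : ℕ) (hn : j < n) :
    ∑ i ∈ Finset.range n, G j i * (-1)^i = if j = 0 then 1 else 0 := by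
  cases j with
  | zero =>
    obtain ⟨n, rfl⟩ := Nat.exists_eq_succ_of_ne_zero hn.ne'
    rw [Finset.sum_range_succ']; simp [G]
  | succ j =>
    obtain ⟨n, rfl⟩ := Nat.exists_eq_succ_of_ne_zero (show n ≠ 0 by omega)
    rw [Nat.succ_eq_add_one, G_sum _ j n (by omega)]
    simp only [Nat.add_eq_zero_iff, one_ne_zero, and_false, if_false]
    apply Finset.sum_eq_zero
    intro i _
    cases i with
    | zero => simp
    | succ i => simp only [Nat.add_sub_cancel]; push_cast; ring

lemma rBell_eq_sum (j : ℕ) : ∀ m n, j < n →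
    (rBell j m : ℚ) = ∑ i ∈ Finset.range n, G j i * (m.descFactorial i : ℚ) := by
  induction j with
  | zero =>
    intro m n hn
    obtain ⟨n, rfl⟩ := Nat.exists_eq_succ_of_ne_zero hn.ne'
    rw [Finset.sum_range_succ', rBell_zero]; simp [G]
  | succ j ih =>
    intro m n hn
    obtain ⟨n, rfl⟩ := Nat.exists_eq_succ_of_ne_zero (show n ≠ 0 by omega)
    rw [Nat.succ_eq_add_one, G_sum _ j n (by omega), rBell_succ]
    push_cast
    rw [ih (m+1) n (by omega), ih m n (by omega), Finset.mul_sum, ← Finset.sum_add_distrib]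
    apply Finset.sum_congr rfl
    intro i _
    have h2 : ((m.descFactorial (i+1) : ℕ) : ℚ) = (m - i) * (m.descFactorial i : ℚ) := by
      rw [Nat.descFactorial_succ]
      rcases le_or_gt i m with h | h
      · push_cast [h]; ring
      · simp [Nat.descFactorial_of_lt h]
    have h1 : (((m+1).descFactorial i : ℕ) : ℚ)
        = (m.descFactorial i : ℚ) + i * (m.descFactorial (i-1) : ℚ) := by
      cases i with
      | zero => simp
      | succ i =>
        rw [Nat.succ_descFactorial_succ, Nat.descFactorial_succ]
        rcases le_or_gt i m with h | h
        · simp only [Nat.add_sub_cancel]; push_cast [h]; ring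
        · simp [Nat.descFactorial_of_lt h]
    rw [h1, h2]; ring

lemma det_rBell (k : ℕ) :
    (Matrix.of fun j m : Fin k => (rBell (j.val + 1) (m.val + 1) : ℚ)).det
      = (∏ i ∈ Finset.range (k + 1), (Nat.factorial i : ℚ)) *
        (∑ i ∈ Finset.range (k + 1), 1 / (Nat.factorial i : ℚ)) := by
  let A : Matrix (Fin (k+1)) (Fin (k+1)) ℚ := Matrix.of fun j i => G j i
  let P : Matrix (Fin (k+1)) (Fin (k+1)) ℚ := Matrix.of fun m i => (m.val.choose i.val : ℚ)
  let d : Fin (k+1) → ℚ := fun i => (Nat.factorial i : ℚ)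
  let D := Matrix.diagonal d
  let M : Matrix (Fin (k+1)) (Fin (k+1)) ℚ := Matrix.of fun j m => (rBell j m : ℚ)
  let v : Fin (k+1) → ℚ := fun i => (-1)^i.val
  have hM : M = A * D * P.transpose := by
    ext j m
    rw [Matrix.mul_apply]
    simp only [M, A, D, P, Matrix.mul_diagonal, Matrix.of_apply,
      Matrix.transpose_apply, d]
    rw [rBell_eq_sum j m (k+1) j.2, Finset.sum_range]
    apply Finset.sum_congr rfl
    intro i _
    rw [Nat.descFactorial_eq_factorial_mul_choose]
    push_cast; ring
  have hA : A.det = 1 := by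
    rw [Matrix.det_of_isLowerTriangular A (fun i j h => G_gt _ _ h)]
    exact Finset.prod_eq_one fun i _ => G_diag _
  have hP : P.det = 1 := by
    rw [Matrix.det_of_isLowerTriangular P
      (fun i j h => by
        have h' : i < j := h
        simp [P, Nat.choose_eq_zero_of_lt h'])]
    exact Finset.prod_eq_one fun i _ => by simp [P]
  have hD : D.det = ∏ i ∈ Finset.range (k + 1), (Nat.factorial i : ℚ) := by
    rw [Matrix.det_diagonal, Finset.prod_range]
  have hAv : A.mulVec v = Pi.single 0 1 := by
    ext j
    simp only [Matrix.mulVec, dotProduct, A, v, Matrix.of_apply]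
    rw [← Finset.sum_range (fun i => G j i * (-1)^i), G_alt j (k+1) j.2]
    simp only [Pi.single_apply, Fin.ext_iff, Fin.val_zero]
  have hPv : P.mulVec v = Pi.single 0 1 := by
    ext j
    simp only [Matrix.mulVec, dotProduct, P, v, Matrix.of_apply]
    rw [← Finset.sum_range (fun i => (j.val.choose i : ℚ) * (-1)^i)]
    have h1 : ∑ i ∈ Finset.range (k+1), (j.val.choose i : ℚ) * (-1)^i
        = ∑ i ∈ Finset.range (j.val+1), (j.val.choose i : ℚ) * (-1)^i := by
      symm
      apply Finset.sum_subset
      · intro x; simp only [Finset.mem_range]; omega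
      · intro x _ hx
        rw [Nat.choose_eq_zero_of_lt (by simpa using hx)]; simp
    have h2 := add_pow (-1 : ℚ) 1 j.val
    rw [h1]
    have h3 : ∑ i ∈ Finset.range (j.val+1), (j.val.choose i : ℚ) * (-1)^i = (0:ℚ)^j.val := by
      rw [← neg_add_cancel (1:ℚ), h2]
      exact Finset.sum_congr rfl fun i _ => by ring
    rw [h3]
    simp only [Pi.single_apply, Fin.ext_iff, Fin.val_zero, zero_pow_eq]
  have hAu : IsUnit A.det := by rw [hA]; exact isUnit_one
  have hPu : IsUnit P.det := by rw [hP]; exact isUnit_one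
  have colA : ∀ i, A⁻¹ i 0 = v i := by
    intro i
    have : A⁻¹.mulVec (A.mulVec v) = v := by
      rw [Matrix.mulVec_mulVec, Matrix.nonsing_inv_mul _ hAu, Matrix.one_mulVec]
    rw [hAv, Matrix.mulVec_single_one] at this
    exact congrFun this i
  have colP : ∀ i, P⁻¹ i 0 = v i := by
    intro i
    have : P⁻¹.mulVec (P.mulVec v) = v := by
      rw [Matrix.mulVec_mulVec, Matrix.nonsing_inv_mul _ hPu, Matrix.one_mulVec]
    rw [hPv, Matrix.mulVec_single_one] at this
    exact congrFun this i
  have hMdet : M.det = ∏ i ∈ Finset.range (k + 1), (Nat.factorial i : ℚ) := by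
    rw [hM, Matrix.det_mul, Matrix.det_mul, Matrix.det_transpose, hA, hP, hD]; ring
  have hMne : M.det ≠ 0 := by
    rw [hMdet]
    exact Finset.prod_ne_zero_iff.2 fun i _ => by exact_mod_cast Nat.factorial_ne_zero i
  have hdinv : D⁻¹ = Matrix.diagonal (fun i => (d i)⁻¹) := by
    apply Matrix.inv_eq_left_inv
    rw [Matrix.diagonal_mul_diagonal, ← Matrix.diagonal_one]
    congr 1
    ext i
    exact inv_mul_cancel₀ (by simp only [d]; exact_mod_cast Nat.factorial_ne_zero i)
  have hinv : M⁻¹ 0 0 = ∑ i ∈ Finset.range (k + 1), 1 / (Nat.factorial i : ℚ) := by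
    rw [hM, Matrix.mul_inv_rev, Matrix.mul_inv_rev, hdinv, ← Matrix.transpose_nonsing_inv,
      Matrix.mul_apply, Finset.sum_range]
    apply Finset.sum_congr rfl
    intro i _
    rw [Matrix.diagonal_mul, Matrix.transpose_apply, colA, colP]
    simp only [v, d]
    have : ((-1:ℚ)^i.val) * (-1)^i.val = 1 := by
      rw [← mul_pow]; simp
    rw [one_div]
    linear_combination ((Nat.factorial i : ℚ))⁻¹ * this
  have hadj : M.adjugate 0 0 = M.det * M⁻¹ 0 0 := by
    rw [Matrix.inv_def, Matrix.smul_apply, smul_eq_mul, Ring.inverse_eq_inv',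
      mul_inv_cancel_left₀ hMne]
  rw [Matrix.adjugate_fin_succ_eq_det_submatrix, hinv, hMdet] at hadj
  rw [← hadj]
  simp only [Fin.val_zero, add_zero, pow_zero, one_mul]
  congr 1

end RBellAux

/-- The determinant of the `k×k` matrix with `(j,m)` entry `(k−m)!·B_{j,m}`
(with `B` the `r`-Bell numbers) equals
`(∏_{i=0}^{k−1} i!) · (∏_{i=0}^{k} i!) · (Σ_{i=0}^{k} 1/i!)`, over the rationals. -/
theorem det_factorial_rBell_matrix (k : ℕ) (hk : 1 ≤ k) :
    (Matrix.of fun j m : Fin k =>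
        ((Nat.factorial (k - (m.val + 1)) : ℚ) * (rBell (j.val + 1) (m.val + 1) : ℚ))).det
      = (∏ i ∈ Finset.range k, (Nat.factorial i : ℚ)) *
        (∏ i ∈ Finset.range (k + 1), (Nat.factorial i : ℚ)) *
        (∑ i ∈ Finset.range (k + 1), 1 / (Nat.factorial i : ℚ)) := by
  have h := Matrix.det_mul_row (fun m : Fin k => (Nat.factorial (k - (m.val + 1)) : ℚ))
    (Matrix.of fun j m : Fin k => (rBell (j.val + 1) (m.val + 1) : ℚ))
  simp only [Matrix.of_apply] at h
  rw [h, RBellAux.det_rBell, ← Finset.prod_range (fun m => (Nat.factorial (k - (m + 1)) : ℚ)),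
    mul_assoc]
  congr 1
  rw [← Finset.prod_range_reflect]
  exact Finset.prod_congr rfl fun i hi => by
    have := Finset.mem_range.1 hi
    congr 2
    omega
end
end

section
/- For every k ≥ 1, the determinant of the k×k matrix with (i,j) entry (−1)^{i+j}·(i+j)! (for 1 ≤ i, j ≤ k) equals the determinant of the k×k matrix with (i,j) entry (i+j)!, namely ∏_{i=0}^{k−1} i! · (i+2)!. -/
theorem det_signed_factorial_matrix (k : ℕ) (hk : 1 ≤ k) :
    (Matrix.of fun i j : Fin k =>
        ((-1 : ℤ) ^ (i.val + 1 + (j.val + 1)) *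
          ((i.val + 1 + (j.val + 1)).factorial : ℤ))).det
      = (Matrix.of fun i j : Fin k =>
          (((i.val + 1 + (j.val + 1)).factorial : ℕ) : ℤ)).det ∧
    (Matrix.of fun i j : Fin k =>
        (((i.val + 1 + (j.val + 1)).factorial : ℕ) : ℤ)).det
      = ∏ i ∈ Finset.range k, ((i.factorial : ℤ) * (((i + 2).factorial : ℕ) : ℤ)) := by
  constructor
  · have h : (Matrix.of fun i j : Fin k =>
        ((-1 : ℤ) ^ (i.val + 1 + (j.val + 1)) *
          ((i.val + 1 + (j.val + 1)).factorial : ℤ)))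
        = Matrix.of fun i j : Fin k => (-1 : ℤ) ^ (i.val + 1) *
          (Matrix.of fun i j : Fin k => (-1 : ℤ) ^ (j.val + 1) *
            (Matrix.of fun i j : Fin k =>
              (((i.val + 1 + (j.val + 1)).factorial : ℕ) : ℤ)) i j) i j := by
      ext i j
      simp only [Matrix.of_apply]
      ring
    rw [h, Matrix.det_mul_column, Matrix.det_mul_row, ← mul_assoc, ← Finset.prod_mul_distrib]
    have h1 : ∀ i : Fin k, (-1 : ℤ) ^ (i.val + 1) * (-1 : ℤ) ^ (i.val + 1) = 1 := by
      intro i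
      rw [← mul_pow]
      simp
    simp [h1]
  · have h : (Matrix.of fun i j : Fin k => (((i.val + 1 + (j.val + 1)).factorial : ℕ) : ℤ))
        = Matrix.of fun i j : Fin k => (((i.val + 2).factorial : ℕ) : ℤ) *
          (Matrix.of fun i j : Fin k =>
            (ascPochhammer ℤ j).eval ((i.val : ℤ) + 3)) i j := by
      ext i j
      simp only [Matrix.of_apply]
      have := ascPochhammer_eval_cast (S := ℤ) j.val (i.val + 3)
      have e : ((i.val + 3 : ℕ) : ℤ) = (i.val : ℤ) + 3 := by push_cast; ring
      rw [e] at this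
      rw [← this, ascPochhammer_nat_eq_ascFactorial, ← Nat.cast_mul,
        Nat.factorial_mul_ascFactorial]
      congr 2
      ring
    rw [h, Matrix.det_mul_column,
      ← Matrix.det_eval_matrixOfPolynomials_eq_det_vandermonde (fun i : Fin k => (i.val : ℤ) + 3)
        (fun j => ascPochhammer ℤ j) (fun j => ascPochhammer_natDegree ℤ j)
        (fun j => monic_ascPochhammer ℤ j),
      Matrix.det_vandermonde_add, Finset.prod_mul_distrib, mul_comm]
    congr 1
    · obtain ⟨n, rfl⟩ : ∃ n, k = n + 1 := ⟨k - 1, by omega⟩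
      rw [Matrix.det_vandermonde_id_eq_superFactorial, ← Nat.prod_range_factorial_succ,
        Finset.prod_range_succ']
      rw [Nat.cast_prod, Nat.factorial_zero, Nat.cast_one, mul_one]
    · exact Fin.prod_univ_eq_prod_range (fun i => (((i + 2).factorial : ℕ) : ℤ)) k
end

section
/- Let G be a finite simple graph with a distinguished vertex v_1 and vertex labels l : V(G) → 2^N such that {l(v) : v ∈ V(G)} is a partition of N. Let A_1,…,A_m be the connected components of G with v_1 ∈ A_1, and suppose that for each j the component A_j is partitioned into two disjoint (possibly empty for one side) independent sets B_j and C_j with B_j ∪ C_j = A_j and v_1 ∈ B_1. Then, as polynomials in ℝ[x]: Σ_{f∈C_2(G)} x^{|l(S_f^1)|} = 2 · x^{|l(B_1)|} · ∏_{j=2}^{m} (x^{|l(B_j)|} + x^{|l(C_j)|}), where C_2(G) is the set of proper 2-colorings of G and S_f^1 is the set of vertices colored with the same color as v_1. -/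
open scoped Classical
noncomputable section

set_option maxHeartbeats 1000000 in
/-- Let `G` be a graph whose vertex labels form a partition of the players `Fin n`,
with connected components `A 0, …, A (m-1)` (with `v₁ ∈ A 0`), each split into two
disjoint independent sets `B j` and `C j` with `v₁ ∈ B 0`. Then, in `ℝ[x]`,
`Σ_{f∈C_2(G)} x^{|l(S_f^1)|} = 2·x^{|l(B 0)|}·∏_{j≠0} (x^{|l(B j)|} + x^{|l(C j)|})`. -/
theorem sum_two_colorings_eq_component_product {V : Type} [Fintype V] [DecidableEq V]
    (n : ℕ) (G : SimpleGraph V) (v1 : V) (l : V → Finset (Fin n))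
    (hl_ne : ∀ v, (l v).Nonempty)
    (hl_disj : ∀ u v, u ≠ v → Disjoint (l u) (l v))
    (hl_cover : ∀ p : Fin n, ∃ v, p ∈ l v)
    (m : ℕ) (hm : 0 < m) (A B C : Fin m → Finset V)
    (hA_ne : ∀ j, (A j).Nonempty)
    (hA_disj : ∀ j j', j ≠ j' → Disjoint (A j) (A j'))
    (hA_components : ∀ u v : V, G.Reachable u v ↔ ∃ j, u ∈ A j ∧ v ∈ A j)
    (hBC_disj : ∀ j, Disjoint (B j) (C j))
    (hBC_union : ∀ j, B j ∪ C j = A j)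
    (hB_indep : ∀ j, ∀ u ∈ B j, ∀ v ∈ B j, ¬ G.Adj u v)
    (hC_indep : ∀ j, ∀ u ∈ C j, ∀ v ∈ C j, ¬ G.Adj u v)
    (hv1 : v1 ∈ B ⟨0, hm⟩) :
    ∑ f ∈ (Finset.univ : Finset (V → Fin 2)).filter
        (fun f => ∀ u v, G.Adj u v → f u ≠ f v),
      (Polynomial.X : Polynomial ℝ) ^
        ((Finset.univ.filter fun v => f v = f v1).biUnion l).card
      = 2 * Polynomial.X ^ ((B ⟨0, hm⟩).biUnion l).card *
          ∏ j ∈ (Finset.univ : Finset (Fin m)).erase ⟨0, hm⟩,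
            (Polynomial.X ^ ((B j).biUnion l).card +
              Polynomial.X ^ ((C j).biUnion l).card) := by
  set z : Fin m := ⟨0, hm⟩ with hz
  have hex : ∀ v, ∃ j, v ∈ A j := fun v => by
    obtain ⟨j, h, _⟩ := (hA_components v v).1 (SimpleGraph.Reachable.refl v)
    exact ⟨j, h⟩
  choose comp hcomp using hex
  have hcu : ∀ v j, v ∈ A j → comp v = j := by
    intro v j h
    by_contra hne
    exact Finset.disjoint_left.1 (hA_disj _ _ hne) (hcomp v) h
  have hBA : ∀ v j, v ∈ B j → comp v = j := fun v j h =>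
    hcu v j (by rw [← hBC_union j]; exact Finset.mem_union_left _ h)
  have hCA : ∀ v j, v ∈ C j → comp v = j := fun v j h =>
    hcu v j (by rw [← hBC_union j]; exact Finset.mem_union_right _ h)
  have hC_iff : ∀ v, v ∈ C (comp v) ↔ ¬ v ∈ B (comp v) := by
    intro v
    have h1 := hcomp v
    rw [← hBC_union, Finset.mem_union] at h1
    have h2 : v ∈ B (comp v) → v ∉ C (comp v) := fun h =>
      Finset.disjoint_left.1 (hBC_disj (comp v)) h
    tauto
  have hadjc : ∀ u v, G.Adj u v → comp u = comp v := by
    intro u v h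
    obtain ⟨j, h1, h2⟩ := (hA_components u v).1 h.reachable
    rw [hcu u j h1, hcu v j h2]
  have hadj : ∀ u v, G.Adj u v → (u ∈ B (comp u) ↔ ¬ v ∈ B (comp v)) := by
    intro u v h
    have hc := hadjc u v h
    have h1 := hB_indep (comp v) u
    have h2 := hC_indep (comp v) u
    have h3 := hC_iff u
    have h4 := hC_iff v
    rw [hc] at h3 ⊢
    constructor
    · intro hu hv
      exact h1 hu v hv h
    · intro hv
      by_contra hu
      exact h2 (h3.2 hu) v (h4.2 hv) h
  have hz1 : comp v1 = z := hBA v1 z hv1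
  have key : ∀ f : V → Fin 2, (∀ u v, G.Adj u v → f u ≠ f v) → ∀ u v, comp u = comp v →
      ((f u = f v1 ↔ u ∈ B (comp u)) ↔ (f v = f v1 ↔ v ∈ B (comp v))) := by
    intro f hf u v huv
    have hr : G.Reachable u v :=
      (hA_components u v).2 ⟨comp v, by rw [← huv]; exact hcomp u, hcomp v⟩
    obtain ⟨p⟩ := hr
    clear huv
    induction p with
    | nil => rfl
    | @cons a b c h p ih =>
      refine Iff.trans ?_ ih
      have h1 := hf a b h
      have h2 := hadj a b h
      have h3 : f a = f v1 ↔ ¬ f b = f v1 := by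
        generalize f a = x at *
        generalize f b = y at *
        generalize f v1 = w at *
        clear * - h1
        revert x y w
        decide
      tauto
  let F : Fin 2 × Finset (Fin m) → V → Fin 2 := fun p v =>
    if ((comp v = z ∨ comp v ∈ p.2) ↔ v ∈ B (comp v)) then p.1 else p.1 + 1
  have hne : ∀ c : Fin 2, c + 1 ≠ c := by decide
  have hF1 : ∀ p, F p v1 = p.1 := by
    intro p
    have : v1 ∈ B (comp v1) := by rw [hz1]; exact hv1
    simp [F, hz1, hv1]
  have hF : ∀ p v, F p v = F p v1 ↔ ((comp v = z ∨ comp v ∈ p.2) ↔ v ∈ B (comp v)) := by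
    intro p v
    rw [hF1]
    by_cases h : ((comp v = z ∨ comp v ∈ p.2) ↔ v ∈ B (comp v))
    · simp only [F, if_pos h, h]
    · simp only [F, if_neg h, h, hne]
  have hcard : ∀ S : Finset V, (S.biUnion l).card = ∑ v ∈ S, (l v).card := fun S =>
    Finset.card_biUnion (fun u _ v _ h => hl_disj u v h)
  have hexp : ∀ p : Fin 2 × Finset (Fin m), p.2 ⊆ Finset.univ.erase z →
      (Polynomial.X : Polynomial ℝ) ^
        ((Finset.univ.filter fun v => F p v = F p v1).biUnion l).card
      = Polynomial.X ^ ((B z).biUnion l).card *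
        ((∏ j ∈ p.2, Polynomial.X ^ ((B j).biUnion l).card) *
          ∏ j ∈ (Finset.univ.erase z) \ p.2, Polynomial.X ^ ((C j).biUnion l).card) := by
    intro p hp
    have hfib : ∀ j, (Finset.univ.filter fun v => F p v = F p v1).filter (fun v => comp v = j)
        = if j = z ∨ j ∈ p.2 then B j else C j := by
      intro j
      ext v
      simp only [Finset.mem_filter, Finset.mem_univ, true_and, hF]
      by_cases hj : comp v = j
      · subst hj
        have := hC_iff v
        split_ifs with h <;> tauto
      · have h1 := mt (hBA v j) hj
        have h2 := mt (hCA v j) hj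
        split_ifs <;> tauto
    have hz2 : z ∉ p.2 := fun h => by simpa using hp h
    rw [hcard, ← Finset.sum_fiberwise _ comp, ← Finset.prod_pow_eq_pow_sum]
    simp only [hfib, ← hcard]
    rw [← Finset.mul_prod_erase _ _ (Finset.mem_univ z), ← Finset.prod_sdiff hp, mul_comm (∏ j ∈ p.2, _)]
    refine congrArg₂ (· * ·) ?_ (congrArg₂ (· * ·) ?_ ?_)
    · rw [if_pos (Or.inl rfl)]
    · refine Finset.prod_congr rfl fun j hj => ?_
      simp only [Finset.mem_sdiff, Finset.mem_erase] at hj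
      rw [if_neg (by tauto)]
    · refine Finset.prod_congr rfl fun j hj => ?_
      rw [if_pos (Or.inr hj)]
  have hR : 2 * Polynomial.X ^ ((B z).biUnion l).card *
          ∏ j ∈ (Finset.univ : Finset (Fin m)).erase z,
            ((Polynomial.X : Polynomial ℝ) ^ ((B j).biUnion l).card +
              Polynomial.X ^ ((C j).biUnion l).card)
      = ∑ p ∈ (Finset.univ : Finset (Fin 2)) ×ˢ ((Finset.univ : Finset (Fin m)).erase z).powerset,
        (Polynomial.X : Polynomial ℝ) ^
        ((Finset.univ.filter fun v => F p v = F p v1).biUnion l).card := by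
    rw [Finset.sum_congr rfl (fun p hp => hexp p
      (Finset.mem_powerset.1 (Finset.mem_product.1 hp).2)), Finset.sum_product]
    simp only [← Finset.mul_sum, Finset.sum_const, Finset.card_univ, Fintype.card_fin]
    rw [Finset.prod_add, nsmul_eq_mul]
    push_cast
    ring
  rw [hR]
  symm
  refine Finset.sum_bij (fun p _ => F p) ?_ ?_ ?_ ?_
  · intro p _
    simp only [Finset.mem_filter, Finset.mem_univ, true_and]
    intro u v h heq
    have h1 := hF p u
    have h2 := hF p v
    have h3 := hadj u v h
    rw [hadjc u v h] at h1 h3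
    rw [heq] at h1
    tauto
  · intro p hp q hq hpq
    have hpq : F p = F q := hpq
    simp only [Finset.mem_product, Finset.mem_univ, true_and, Finset.mem_powerset] at hp hq
    refine Prod.ext ?_ ?_
    · rw [← hF1 p, ← hF1 q, hpq]
    · ext j
      by_cases hj : j = z
      · have h1 : j ∉ p.2 := fun h => by simpa [hj] using hp h
        have h2 : j ∉ q.2 := fun h => by simpa [hj] using hq h
        tauto
      obtain ⟨v, hv⟩ := hA_ne j
      have hvj := hcu v j hv
      have h1 := hF p v
      have h2 := hF q v
      rw [hvj] at h1 h2
      rw [hpq] at h1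
      tauto
  · intro f hf
    simp only [Finset.mem_filter, Finset.mem_univ, true_and] at hf
    refine ⟨(f v1, (Finset.univ.erase z).filter fun j =>
      ∃ v, comp v = j ∧ (f v = f v1 ↔ v ∈ B (comp v))), ?_, ?_⟩
    · simp only [Finset.mem_product, Finset.mem_univ, true_and, Finset.mem_powerset]
      exact Finset.filter_subset _ _
    · set p : Fin 2 × Finset (Fin m) := (f v1, (Finset.univ.erase z).filter fun j =>
        ∃ v, comp v = j ∧ (f v = f v1 ↔ v ∈ B (comp v))) with hp
      have hG : ∀ v, (comp v = z ∨ comp v ∈ p.2) ↔ (f v = f v1 ↔ v ∈ B (comp v)) := by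
        intro v
        by_cases hv : comp v = z
        · have h1 := key f hf v v1 (by rw [hv, hz1])
          have h2 : v1 ∈ B (comp v1) := by rw [hz1]; exact hv1
          simp only [h2, iff_true] at h1
          tauto
        · simp only [hp, hv, false_or, Finset.mem_filter, Finset.mem_erase, Finset.mem_univ,
            ne_eq, not_false_eq_true, true_and]
          constructor
          · rintro ⟨u, hu, h⟩
            exact (key f hf u v hu).1 h
          · intro h
            exact ⟨v, rfl, h⟩
      funext v
      have h1 := hF p v
      have h2 := hG v
      have h3 : F p v1 = f v1 := hF1 p
      rw [h3] at h1
      have h4 : F p v = f v1 ↔ f v = f v1 := by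
        rw [h1, h2]
        clear * -
        tauto
      have h5 : ∀ a b c : Fin 2, (a = c ↔ b = c) → a = b := by decide
      exact h5 _ _ _ h4
  · intro p _
    rfl
end
end
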